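/- arXiv:math/0610984 — 2 statements merged into one kernel-verified Lean document; each statement's English description precedes it below -/
import Mathlib

section
/- Let P be a labeled poset. Then the set of all enriched P-partitions is the disjoint union, over all linear extensions π of P, of the sets of enriched π-partitions: E(P;S^±) = ⨆_{π ∈ L(P)} E(π;S^±). -/
/-- A labeled poset: a finite set of (distinct) positive integers
together with a strict partial order on them. -/
structure LabeledPoset where
  carrier : Finset ℕ+
  lt : ℕ+ → ℕ+ → Prop
  mem_of_lt : ∀ {a b}, lt a b → a ∈ carrier ∧ b ∈ carrier
  lt_irrefl : ∀ a, ¬ lt a a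
  lt_trans : ∀ {a b c}, lt a b → lt b c → lt a c

/-- The strict total order determined by a list: `a` occurs (strictly) before `b`. -/
def chainRel {α : Type*} (l : List α) (a b : α) : Prop :=
  ∃ i j : Fin l.length, i < j ∧ l.get i = a ∧ l.get j = b

/-- `π` is a linear extension of the poset whose elements are given by `mem`
and whose order is `r`. -/
def IsLinearExtension {α : Type*} (mem : α → Prop) (r : α → α → Prop) (π : List α) : Prop :=
  π.Nodup ∧ (∀ x, x ∈ π ↔ mem x) ∧ ∀ a b, r a b → chainRel π a b

/-- `f` is an enriched `P`-partition for the strict order `r` on the carrier `c`.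
The target `S^± = Lex (S × Bool)` is `S` with a sign attached to each element,
ordered `−s₁ < s₁ < −s₂ < s₂ < ⋯` (`false` is the sign `−`, `true` is `+`):
`f i ≤⁺ f j` whenever `i <_P j` and `i < j` as integers, and `f i ≤⁻ f j`
whenever `i <_P j` and `i > j` as integers. -/
def IsEnrichedPPartition {S : Type*} [LinearOrder S] {c : Finset ℕ+} (r : ℕ+ → ℕ+ → Prop)
    (f : {x // x ∈ c} → Lex (S × Bool)) : Prop :=
  ∀ a b : {x // x ∈ c}, r a.1 b.1 →
    ((a : ℕ+) < (b : ℕ+) → f a < f b ∨ (f a = f b ∧ (ofLex (f a)).2 = true)) ∧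
    ((b : ℕ+) < (a : ℕ+) → f a < f b ∨ (f a = f b ∧ (ofLex (f a)).2 = false))

/-- The sort key: the value of `f`, ties broken by the label (reversed for negative sign). -/
def keyFun {S : Type*} [LinearOrder S] {c : Finset ℕ+} (f : {x // x ∈ c} → Lex (S × Bool))
    (a : {x // x ∈ c}) : Lex (Lex (S × Bool) × ℤ) :=
  toLex (f a, if (ofLex (f a)).2 = true then ((a.1 : ℕ) : ℤ) else -((a.1 : ℕ) : ℤ))

theorem keyFun_lt {S : Type*} [LinearOrder S] {c : Finset ℕ+}
    (f : {x // x ∈ c} → Lex (S × Bool)) (a b : {x // x ∈ c}) :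
    keyFun f a < keyFun f b ↔ f a < f b ∨ (f a = f b ∧
      (((ofLex (f a)).2 = true ∧ a.1 < b.1) ∨ ((ofLex (f a)).2 = false ∧ b.1 < a.1))) := by
  unfold keyFun
  rw [Prod.Lex.toLex_lt_toLex]
  refine or_congr Iff.rfl (and_congr_right fun h => ?_)
  change f a = f b at h
  simp only [← h]
  cases (ofLex (f a)).2 <;> simp

theorem keyFun_inj {S : Type*} [LinearOrder S] {c : Finset ℕ+}
    (f : {x // x ∈ c} → Lex (S × Bool)) : Function.Injective (keyFun f) := by
  intro a b h
  by_contra hab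
  have hne : a.1 ≠ b.1 := fun h => hab (Subtype.ext h)
  have h1 := (keyFun_lt f a b).not.1 h.not_lt
  have h2 := (keyFun_lt f b a).not.1 h.not_gt
  have hf : f a = f b := congrArg (fun x => (ofLex x).1) h
  rcases lt_or_gt_of_ne hne with h3 | h3 <;> cases h4 : (ofLex (f b)).2 <;> simp_all

theorem enriched_iff {S : Type*} [LinearOrder S] {c : Finset ℕ+} (r : ℕ+ → ℕ+ → Prop)
    (f : {x // x ∈ c} → Lex (S × Bool)) :
    IsEnrichedPPartition r f ↔
      ∀ a b : {x // x ∈ c}, r a.1 b.1 → a ≠ b → keyFun f a < keyFun f b := by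
  refine forall_congr' fun a => forall_congr' fun b => imp_congr_right fun _ => ?_
  rw [keyFun_lt]
  rcases lt_trichotomy a.1 b.1 with h | h | h
  · have hne : a ≠ b := fun e => h.ne (congrArg _ e)
    simp [h, h.not_gt, hne, -Subtype.coe_lt_coe]
  · have : a = b := Subtype.ext h
    simp [this]
  · have hne : a ≠ b := fun e => h.ne' (congrArg _ e)
    simp [h, h.not_gt, hne, -Subtype.coe_lt_coe]

theorem pairwise_iff_chainRel {α : Type*} (l : List α) (R : α → α → Prop) :
    l.Pairwise R ↔ ∀ a b, chainRel l a b → R a b := by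
  rw [List.pairwise_iff_get]
  constructor
  · rintro h a b ⟨i, j, hij, rfl, rfl⟩
    exact h i j hij
  · intro h i j hij
    exact h _ _ ⟨i, j, hij, rfl, rfl⟩

theorem chainRel_total {α : Type*} {l : List α} {a b : α} (ha : a ∈ l) (hb : b ∈ l)
    (hab : a ≠ b) : chainRel l a b ∨ chainRel l b a := by
  obtain ⟨i, rfl⟩ := List.mem_iff_get.1 ha
  obtain ⟨j, rfl⟩ := List.mem_iff_get.1 hb
  rcases lt_trichotomy i j with h | h | h
  · exact Or.inl ⟨i, j, h, rfl, rfl⟩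
  · exact absurd (h ▸ rfl) hab
  · exact Or.inr ⟨j, i, h, rfl, rfl⟩

theorem chainRel_ne {α : Type*} {l : List α} (hl : l.Nodup) {a b : α}
    (h : chainRel l a b) : a ≠ b :=
  (pairwise_iff_chainRel l (· ≠ ·)).1 hl a b h

/-- The key order transported to labels. -/
def keyRel {S : Type*} [LinearOrder S] {c : Finset ℕ+} (f : {x // x ∈ c} → Lex (S × Bool))
    (x y : ℕ+) : Prop :=
  ∃ (hx : x ∈ c) (hy : y ∈ c), keyFun f ⟨x, hx⟩ < keyFun f ⟨y, hy⟩

theorem enriched_chain_iff {S : Type*} [LinearOrder S] {c : Finset ℕ+} {π : List ℕ+}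
    (hn : π.Nodup) (hm : ∀ x, x ∈ π ↔ x ∈ c) (f : {x // x ∈ c} → Lex (S × Bool)) :
    IsEnrichedPPartition (chainRel π) f ↔ π.Pairwise (keyRel f) := by
  rw [enriched_iff, pairwise_iff_chainRel]
  constructor
  · intro h a b hab
    have hab' := hab
    obtain ⟨i, j, _, hi, hj⟩ := hab'
    have ha : a ∈ c := (hm a).1 (hi ▸ List.get_mem _ _)
    have hb : b ∈ c := (hm b).1 (hj ▸ List.get_mem _ _)
    exact ⟨ha, hb, h ⟨a, ha⟩ ⟨b, hb⟩ hab
      fun e => chainRel_ne hn hab (congrArg Subtype.val e)⟩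
  · intro h a b hab _
    obtain ⟨_, _, h3⟩ := h _ _ hab
    exact h3

theorem exists_sorted {S : Type*} [LinearOrder S] {c : Finset ℕ+}
    (f : {x // x ∈ c} → Lex (S × Bool)) :
    ∃ π : List ℕ+, π.Nodup ∧ (∀ x, x ∈ π ↔ x ∈ c) ∧ π.Pairwise (keyRel f) := by
  classical
  let r : {x // x ∈ c} → {x // x ∈ c} → Prop := fun a b => keyFun f a ≤ keyFun f b
  haveI : Std.Total r := ⟨fun a b => le_total _ _⟩
  haveI : IsTrans _ r := ⟨fun a b c => le_trans⟩
  let l := c.attach.toList.insertionSort r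
  have hp : l.Perm c.attach.toList := List.perm_insertionSort r _
  have hn : l.Nodup := hp.nodup_iff.2 c.attach.nodup_toList
  have hs : l.Pairwise r := List.pairwise_insertionSort r _
  refine ⟨l.map Subtype.val, hn.map Subtype.val_injective, ?_, ?_⟩
  · intro x
    simp [hp.mem_iff]
  · rw [List.pairwise_map]
    refine (hs.and hn).imp ?_
    rintro a b ⟨h1, h2⟩
    exact ⟨a.2, b.2, lt_of_le_of_ne h1 fun e => h2 (keyFun_inj f e)⟩

/-- The set of all enriched `P`-partitions `E(P;S^±)` is the disjoint union over
all linear extensions `π ∈ L(P)` of the sets of enriched `π`-partitions. -/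
theorem statement7 (P : LabeledPoset) (S : Type*) [LinearOrder S] [Countable S] :
    ({f : {x // x ∈ P.carrier} → Lex (S × Bool) | IsEnrichedPPartition P.lt f} =
      ⋃ π ∈ {π : List ℕ+ | IsLinearExtension (· ∈ P.carrier) P.lt π},
        {f : {x // x ∈ P.carrier} → Lex (S × Bool) | IsEnrichedPPartition (chainRel π) f}) ∧
    ∀ π ∈ {π : List ℕ+ | IsLinearExtension (· ∈ P.carrier) P.lt π},
      ∀ π' ∈ {π : List ℕ+ | IsLinearExtension (· ∈ P.carrier) P.lt π}, π ≠ π' →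
        Disjoint
          {f : {x // x ∈ P.carrier} → Lex (S × Bool) | IsEnrichedPPartition (chainRel π) f}
          {f : {x // x ∈ P.carrier} → Lex (S × Bool) | IsEnrichedPPartition (chainRel π') f} := by
  refine ⟨?_, ?_⟩
  · ext f
    simp only [Set.mem_iUnion, Set.mem_setOf_eq, exists_prop]
    constructor
    · intro hf
      obtain ⟨π, hn, hm, hs⟩ := exists_sorted f
      refine ⟨π, ⟨hn, hm, ?_⟩, (enriched_chain_iff hn hm f).2 hs⟩
      intro a b hab
      obtain ⟨ha, hb⟩ := P.mem_of_lt hab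
      have hne : a ≠ b := fun e => P.lt_irrefl b (e ▸ hab)
      rcases chainRel_total ((hm a).2 ha) ((hm b).2 hb) hne with h | h
      · exact h
      · obtain ⟨_, _, h3⟩ := (pairwise_iff_chainRel _ _).1 hs _ _ h
        exact absurd h3 ((enriched_iff _ f).1 hf ⟨a, ha⟩ ⟨b, hb⟩ hab
          fun e => hne (congrArg Subtype.val e)).not_gt
    · rintro ⟨π, ⟨_, _, hl⟩, hf⟩ a b hab
      exact hf a b (hl _ _ hab)
  · rintro π ⟨hn, hm, _⟩ π' ⟨hn', hm', _⟩ hne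
    rw [Set.disjoint_left]
    intro f hf hf'
    have h1 := (enriched_chain_iff hn hm f).1 hf
    have h2 := (enriched_chain_iff hn' hm' f).1 hf'
    have hp : π.Perm π' := (List.perm_ext_iff_of_nodup hn hn').2 fun x => (hm x).trans (hm' x).symm
    refine hne (List.Perm.eq_of_pairwise ?_ h1 h2 hp)
    rintro a b _ _ ⟨_, _, h3⟩ ⟨_, _, h4⟩
    exact absurd h3 h4.not_gt
end

section
/- Let P be a non-empty m-colored poset and let k be the number of distinct colors appearing among the elements of P. Then the number of m-colored enriched P-partitions f : P → (ℙ_m)^± satisfying |f(i)| = ω^{ε(i)}1 for every i ∈ P equals 2^k times the number of linear extensions π = π₁⋯πₙ ∈ L(P) such that Pe(π) = ∅ and ε(π₁) ≤ ε(π₂) ≤ ⋯ ≤ ε(πₙ). (This computes the odd character value ν_P(P) = ζ_Q(Λ_m(P)).) -/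
/-- An `m`-colored poset: a finite set of `m`-colored positive integers
(`ℙ_m = Lex (ℕ+ × Fin m)`, ordered `1 < ω1 < ⋯ < ω^{m−1}1 < 2 < ω2 < ⋯`)
with pairwise distinct absolute values, with a strict partial order. -/
structure ColoredPoset (m : ℕ) where
  carrier : Finset (Lex (ℕ+ × Fin m))
  lt : Lex (ℕ+ × Fin m) → Lex (ℕ+ × Fin m) → Prop
  mem_of_lt : ∀ {a b}, lt a b → a ∈ carrier ∧ b ∈ carrier
  lt_irrefl : ∀ a, ¬ lt a a
  lt_trans : ∀ {a b c}, lt a b → lt b c → lt a c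
  distinct_abs : ∀ a ∈ carrier, ∀ b ∈ carrier, (ofLex a).1 = (ofLex b).1 → a = b

/-- `f` is an `m`-colored enriched `P`-partition for the strict order `r` on
the carrier `c ⊆ ℙ_m`, with values in `(ℙ_m)^± = Lex (ℙ_m × Bool)` (ordered
`−1 < 1 < −ω1 < ω1 < ⋯`, `false` being the sign `−` and `true` the sign `+`):
`ε(|f i|) = ε(i)` for all `i`, `f i ≤⁺ f j` whenever `i <_P j` and `i < j` in
`ℙ_m`, and `f i ≤⁻ f j` whenever `i <_P j` and `i > j` in `ℙ_m`. -/
def IsColoredEnrichedPPartition {m : ℕ} {c : Finset (Lex (ℕ+ × Fin m))}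
    (r : Lex (ℕ+ × Fin m) → Lex (ℕ+ × Fin m) → Prop)
    (f : {x // x ∈ c} → Lex (Lex (ℕ+ × Fin m) × Bool)) : Prop :=
  (∀ i : {x // x ∈ c}, (ofLex ((ofLex (f i)).1)).2 = (ofLex i.1).2) ∧
  ∀ a b : {x // x ∈ c}, r a.1 b.1 →
    (a.1 < b.1 → f a < f b ∨ (f a = f b ∧ (ofLex (f a)).2 = true)) ∧
    (b.1 < a.1 → f a < f b ∨ (f a = f b ∧ (ofLex (f a)).2 = false))

section Helpers

variable {m : ℕ}

def colr (x : Lex (ℕ+ × Fin m)) : Fin m := (ofLex x).2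

/-- the strict total order attached to a sign function -/
def bef (s : Lex (ℕ+ × Fin m) → Bool) (a b : Lex (ℕ+ × Fin m)) : Prop :=
  colr a < colr b ∨ (colr a = colr b ∧ ((a < b ∧ s b = true) ∨ (b < a ∧ s a = false)))

theorem bef_irrefl (s : Lex (ℕ+ × Fin m) → Bool) (a) : ¬ bef s a a := by
  simp [bef]

theorem bef_trans (s : Lex (ℕ+ × Fin m) → Bool) {a b c} (h1 : bef s a b) (h2 : bef s b c) :
    bef s a c := by
  unfold bef at *
  rcases h1 with h1 | ⟨e1, h1⟩ <;> rcases h2 with h2 | ⟨e2, h2⟩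
  · exact Or.inl (h1.trans h2)
  · exact Or.inl (e2 ▸ h1)
  · exact Or.inl (e1 ▸ h2)
  · refine Or.inr ⟨e1.trans e2, ?_⟩
    rcases h1 with ⟨h1, s1⟩ | ⟨h1, s1⟩ <;> rcases h2 with ⟨h2, s2⟩ | ⟨h2, s2⟩
    · exact Or.inl ⟨h1.trans h2, s2⟩
    · simp_all
    · rcases lt_trichotomy a c with h | h | h
      · exact Or.inl ⟨h, s2⟩
      · subst h; simp_all
      · exact Or.inr ⟨h, s1⟩
    · exact Or.inr ⟨h2.trans h1, s1⟩

theorem bef_total (s : Lex (ℕ+ × Fin m) → Bool) {a b} (h : a ≠ b) : bef s a b ∨ bef s b a := by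
  unfold bef
  rcases lt_trichotomy (colr a) (colr b) with hc | hc | hc
  · exact Or.inl (Or.inl hc)
  · rcases lt_or_gt_of_ne h with h | h
    · rcases Bool.eq_false_or_eq_true (s b) with hs | hs
      rotate_left
      · exact Or.inr (Or.inr ⟨hc.symm, Or.inr ⟨h, hs⟩⟩)
      · exact Or.inl (Or.inr ⟨hc, Or.inl ⟨h, hs⟩⟩)
    · rcases Bool.eq_false_or_eq_true (s a) with hs | hs
      rotate_left
      · exact Or.inl (Or.inr ⟨hc, Or.inr ⟨h, hs⟩⟩)
      · exact Or.inr (Or.inr ⟨hc.symm, Or.inl ⟨h, hs⟩⟩)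
  · exact Or.inr (Or.inl hc)

theorem exists_sorted_s19 (s : Lex (ℕ+ × Fin m) → Bool) (c : Finset (Lex (ℕ+ × Fin m))) :
    ∃ l : List (Lex (ℕ+ × Fin m)), l.Nodup ∧ (∀ x, x ∈ l ↔ x ∈ c) ∧ l.Pairwise (bef s) := by
  classical
  let r : Lex (ℕ+ × Fin m) → Lex (ℕ+ × Fin m) → Prop := fun a b => a = b ∨ bef s a b
  have i1 : Std.Total r := ⟨fun a b => by
    by_cases h : a = b
    · exact Or.inl (Or.inl h)
    · exact (bef_total s h).imp Or.inr Or.inr⟩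
  have i2 : IsTrans _ r := ⟨fun a b c h1 h2 => by
    rcases h1 with rfl | h1
    · exact h2
    · rcases h2 with rfl | h2
      · exact Or.inr h1
      · exact Or.inr (bef_trans s h1 h2)⟩
  have i3 : Std.Antisymm r := ⟨fun a b h1 h2 => by
    rcases h1 with rfl | h1
    · rfl
    · rcases h2 with rfl | h2
      · rfl
      · exact absurd (bef_trans s h1 h2) (bef_irrefl s a)⟩
  refine ⟨c.sort r, c.sort_nodup r, fun x => c.mem_sort r, ?_⟩
  have h1 : (c.sort r).Pairwise r := c.pairwise_sort r
  have h2 : (c.sort r).Pairwise (· ≠ ·) := c.sort_nodup r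
  exact (h1.and h2).imp (fun {a b} h => h.1.resolve_left h.2)

theorem sorted_unique (s : Lex (ℕ+ × Fin m) → Bool) (l l' : List (Lex (ℕ+ × Fin m)))
    (h : l.Nodup) (h' : l'.Nodup) (hm : ∀ x, x ∈ l ↔ x ∈ l') (hp : l.Pairwise (bef s))
    (hp' : l'.Pairwise (bef s)) : l = l' := by
  have : l.Perm l' := (List.perm_ext_iff_of_nodup h h').2 hm
  exact this.eq_of_pairwise
    (fun a b _ _ h1 h2 => absurd (bef_trans s h1 h2) (bef_irrefl s a)) hp hp'

theorem chainRel_of_pairwise (s : Lex (ℕ+ × Fin m) → Bool) (l : List (Lex (ℕ+ × Fin m)))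
    (hp : l.Pairwise (bef s)) {a b} (ha : a ∈ l) (hb : b ∈ l) (hab : bef s a b) :
    chainRel l a b := by
  obtain ⟨i, hi⟩ := List.get_of_mem ha
  obtain ⟨j, hj⟩ := List.get_of_mem hb
  refine ⟨i, j, ?_, hi, hj⟩
  rcases lt_trichotomy i j with h | h | h
  · exact h
  · subst h
    rw [hi] at hj; subst hj
    exact absurd hab (bef_irrefl s _)
  · have := List.pairwise_iff_get.1 hp j i h
    rw [hi, hj] at this
    exact absurd (bef_trans s hab this) (bef_irrefl s _)

theorem bef_of_chainRel (s : Lex (ℕ+ × Fin m) → Bool) (l : List (Lex (ℕ+ × Fin m)))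
    (hp : l.Pairwise (bef s)) {a b} (h : chainRel l a b) : bef s a b := by
  obtain ⟨i, j, hij, rfl, rfl⟩ := h
  exact List.pairwise_iff_get.1 hp i j hij

/-- the no-peak condition -/
def NoPeak (π : List (Lex (ℕ+ × Fin m))) : Prop :=
  ∀ t ∈ π.zip (π.tail.zip π.tail.tail),
            (ofLex t.1).2 = (ofLex t.2.1).2 → (ofLex t.2.1).2 = (ofLex t.2.2).2 →
            ¬(t.1 < t.2.1 ∧ t.2.2 < t.2.1)

theorem noPeak_iff (π : List (Lex (ℕ+ × Fin m))) : NoPeak π ↔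
    ∀ (r : ℕ) (h : r + 2 < π.length), colr π[r] = colr π[r+1] → colr π[r+1] = colr π[r+2] →
      ¬ (π[r] < π[r+1] ∧ π[r+2] < π[r+1]) := by
  unfold NoPeak colr
  constructor
  · intro H r h
    have := H (π[r], π[r+1], π[r+2]) (by
      rw [List.mem_iff_getElem]
      refine ⟨r, by simp; omega, by simp⟩)
    exact this
  · intro H t ht
    rw [List.mem_iff_getElem] at ht
    obtain ⟨r, hr, rfl⟩ := ht
    have hr' : r + 2 < π.length := by simp at hr; omega
    simpa using H r hr'

theorem noPeak_of_pairwise (s : Lex (ℕ+ × Fin m) → Bool) (l : List (Lex (ℕ+ × Fin m)))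
    (hp : l.Pairwise (bef s)) : NoPeak l := by
  rw [noPeak_iff]
  rintro r h e1 e2 ⟨h1, h2⟩
  have a1 := List.pairwise_iff_getElem.1 hp r (r+1) (by omega) (by omega) (by omega)
  have a2 := List.pairwise_iff_getElem.1 hp (r+1) (r+2) (by omega) (by omega) (by omega)
  unfold bef at a1 a2
  simp [e1, h1, h1.not_gt] at a1
  simp [e2, h2, h2.not_gt] at a2
  simp_all

theorem no_big_peak (l : List (Lex (ℕ+ × Fin m))) (hnd : l.Nodup) (hpk : NoPeak l)
    (hc : l.Pairwise (fun a b => colr a ≤ colr b)) (i j k : ℕ) (hij : i < j) (hjk : j < k)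
    (hk : k < l.length) (e1 : colr l[i] = colr l[k]) (h1 : l[i] < l[j]) (h2 : l[k] < l[j]) :
    False := by
  rw [noPeak_iff] at hpk
  have hcol : ∀ p, i ≤ p → (hp : p ≤ k) → colr (l[p]'(by omega)) = colr l[k] := by
    intro p h1 h2
    have mono : ∀ p q, (hpq : p ≤ q) → (hq : q < l.length) → colr (l[p]'(hpq.trans_lt hq)) ≤ colr l[q] := by
      intro p q hpq hq
      rcases hpq.eq_or_lt with rfl | h
      · exact le_rfl
      · exact List.pairwise_iff_getElem.1 hc p q (by omega) hq h
    exact le_antisymm (mono p k h2 hk) (e1 ▸ mono i p h1 (by omega))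
  obtain ⟨p, hp, hmax⟩ := Finset.exists_max_image
    (Finset.univ.filter (fun p : Fin l.length => i ≤ p.1 ∧ p.1 ≤ k)) (fun p => l[p.1])
    ⟨⟨j, by omega⟩, by simp; omega⟩
  obtain ⟨p, hpl⟩ := p
  simp only [Finset.mem_filter, Finset.mem_univ, true_and] at hp hmax
  have hj := hmax ⟨j, by omega⟩ ⟨hij.le, hjk.le⟩
  simp only at hj
  have hpi : p ≠ i := by rintro rfl; exact absurd hj h1.not_ge
  have hpk' : p ≠ k := by rintro rfl; exact absurd hj h2.not_ge
  obtain ⟨q, rfl⟩ : ∃ q, p = q + 1 := ⟨p - 1, by omega⟩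
  have n1 : l[q] < l[q+1] := lt_of_le_of_ne (hmax ⟨q, by omega⟩ (by simp; omega)) (by
    intro h
    have := (hnd.getElem_inj_iff).1 h
    omega)
  have n2 : l[q+2] < l[q+1] := lt_of_le_of_ne (hmax ⟨q+2, by omega⟩ (by simp; omega)) (by
    intro h
    have := (hnd.getElem_inj_iff).1 h
    omega)
  refine hpk q (by omega) ?_ ?_ ⟨n1, n2⟩
  · rw [hcol q (by omega) (by omega), hcol (q+1) (by omega) (by omega)]
  · rw [hcol (q+1) (by omega) (by omega), hcol (q+2) (by omega) (by omega)]

/-- total extension of the sign function of `f` -/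
noncomputable def sg {c : Finset (Lex (ℕ+ × Fin m))}
    (f : {x // x ∈ c} → Lex (Lex (ℕ+ × Fin m) × Bool)) (x : Lex (ℕ+ × Fin m)) : Bool :=
  open Classical in if h : x ∈ c then (ofLex (f ⟨x, h⟩)).2 else false

theorem enriched_iff_s19 (P : ColoredPoset m)
    (f : {x // x ∈ P.carrier} → Lex (Lex (ℕ+ × Fin m) × Bool))
    (hf : ∀ i, (ofLex (f i)).1 = toLex ((1 : ℕ+), (ofLex i.1).2)) :
    IsColoredEnrichedPPartition P.lt f ↔ ∀ a b, P.lt a b → bef (sg f) a b := by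
  have key : ∀ a b : {x // x ∈ P.carrier}, a.1 ≠ b.1 → (bef (sg f) a.1 b.1 ↔
    (a.1 < b.1 → f a < f b ∨ (f a = f b ∧ (ofLex (f a)).2 = true)) ∧
    (b.1 < a.1 → f a < f b ∨ (f a = f b ∧ (ofLex (f a)).2 = false))) := by
    intro a b hab
    have fl : f a < f b ↔ colr a.1 < colr b.1 ∨ (colr a.1 = colr b.1 ∧ 
        (ofLex (f a)).2 < (ofLex (f b)).2) := by
      rw [Prod.Lex.lt_iff, hf, hf, Prod.Lex.lt_iff]
      simp [colr]
    have fe : f a = f b ↔ colr a.1 = colr b.1 ∧ (ofLex (f a)).2 = (ofLex (f b)).2 := by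
      rw [← ofLex_inj, Prod.ext_iff, hf, hf]
      simp [colr]
    have sa : sg f a.1 = (ofLex (f a)).2 := by simp [sg]
    have sb : sg f b.1 = (ofLex (f b)).2 := by simp [sg]
    rw [fl, fe]
    unfold bef
    rw [sa, sb]
    generalize (ofLex (f a)).2 = u
    generalize (ofLex (f b)).2 = v
    rcases lt_or_gt_of_ne hab with h | h
    · cases u <;> cases v <;> simp [h, h.not_gt, le_iff_lt_or_eq]
    · cases u <;> cases v <;> simp [h, h.not_gt, le_iff_lt_or_eq]
  have ne : ∀ a b, P.lt a b → a ≠ b := by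
    rintro a b h rfl
    exact P.lt_irrefl a h
  constructor
  · intro H a b hab
    obtain ⟨ha, hb⟩ := P.mem_of_lt hab
    exact (key ⟨a, ha⟩ ⟨b, hb⟩ (ne _ _ hab)).2 (H.2 ⟨a, ha⟩ ⟨b, hb⟩ hab)
  · intro H
    refine ⟨fun i => by rw [hf]; rfl, fun a b hab => ?_⟩
    exact (key a b (ne _ _ hab)).1 (H _ _ hab)

theorem exists_mins (c : Finset (Lex (ℕ+ × Fin m))) :
    ∀ k : {k // k ∈ c.image (fun z => (ofLex z).2)}, ∃ μ ∈ c, colr μ = k.1 ∧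
      ∀ x ∈ c, colr x = k.1 → μ ≤ x := by
  rintro ⟨k, hk⟩
  obtain ⟨z, hz, e⟩ := Finset.mem_image.1 hk
  obtain ⟨μ, hμ, h⟩ := Finset.exists_min_image (c.filter (fun z => colr z = k)) id
    ⟨z, Finset.mem_filter.2 ⟨hz, e⟩⟩
  simp only [Finset.mem_filter, id] at hμ h
  exact ⟨μ, hμ.1, hμ.2, fun x hx hc => h x ⟨hx, hc⟩⟩

theorem exists_sign (c : Finset (Lex (ℕ+ × Fin m)))
    (μ : {k // k ∈ c.image (fun z => (ofLex z).2)} → Lex (ℕ+ × Fin m))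
    (hμ : ∀ k, μ k ∈ c ∧ colr (μ k) = k.1 ∧ ∀ x ∈ c, colr x = k.1 → μ k ≤ x)
    (g : {k // k ∈ c.image (fun z => (ofLex z).2)} → Bool)
    (l : List (Lex (ℕ+ × Fin m))) (hnd : l.Nodup) (hm : ∀ x, x ∈ l ↔ x ∈ c) (hpk : NoPeak l)
    (hc : l.Pairwise (fun a b => colr a ≤ colr b)) :
    ∃ s : Lex (ℕ+ × Fin m) → Bool, (∀ k, s (μ k) = g k) ∧ l.Pairwise (bef s) := by
  classical
  let s : Lex (ℕ+ × Fin m) → Bool := fun x =>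
    if h : x ∈ c then
      let k : {k // k ∈ c.image (fun z => (ofLex z).2)} :=
        ⟨colr x, Finset.mem_image.2 ⟨x, h, rfl⟩⟩
      if x = μ k then g k else decide (chainRel l (μ k) x)
    else false
  refine ⟨s, fun k => ?_, ?_⟩
  · obtain ⟨h1, h2, _⟩ := hμ k
    have : (⟨colr (μ k), Finset.mem_image.2 ⟨_, h1, rfl⟩⟩ :
      {k // k ∈ c.image (fun z => (ofLex z).2)}) = k := Subtype.ext h2
    simp only [s, h1, dif_pos, this, if_true]
  · rw [List.pairwise_iff_getElem]
    intro i j hi hj hij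
    have hcc := List.pairwise_iff_getElem.1 hc i j hi hj hij
    rcases hcc.lt_or_eq with h | heq
    · exact Or.inl h
    refine Or.inr ⟨heq, ?_⟩
    have mi : l[i] ∈ c := (hm _).1 (List.getElem_mem _)
    have mj : l[j] ∈ c := (hm _).1 (List.getElem_mem _)
    have hne : l[i] ≠ l[j] := by
      intro h
      have := (hnd.getElem_inj_iff).1 h
      omega
    rcases lt_or_gt_of_ne hne with h | h
    · refine Or.inl ⟨h, ?_⟩
      simp only [s, mj, dif_pos]
      generalize hk : (⟨colr l[j], _⟩ : {k // k ∈ c.image (fun z => (ofLex z).2)}) = k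
      have hk' : colr l[j] = k.1 := by rw [← hk]
      obtain ⟨h1, h2, h3⟩ := hμ k
      have hle := h3 _ mi (heq.trans hk')
      rw [if_neg (hle.trans_lt h).ne', decide_eq_true_iff]
      obtain ⟨p, hp, hpe⟩ := List.mem_iff_getElem.1 ((hm _).2 h1)
      refine ⟨⟨p, hp⟩, ⟨j, hj⟩, ?_, hpe, rfl⟩
      show p < j
      by_contra hcon
      have hpj : p ≠ j := by
        rintro rfl
        exact (hle.trans_lt h).ne hpe.symm
      exact no_big_peak l hnd hpk hc i j p hij (by omega) hp (by rw [hpe, h2, heq, hk']) h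
        (by rw [hpe]; exact hle.trans_lt h)
    · refine Or.inr ⟨h, ?_⟩
      simp only [s, mi, dif_pos]
      generalize hk : (⟨colr l[i], _⟩ : {k // k ∈ c.image (fun z => (ofLex z).2)}) = k
      have hk' : colr l[i] = k.1 := by rw [← hk]
      obtain ⟨h1, h2, h3⟩ := hμ k
      have hle := h3 _ mj (heq.symm.trans hk')
      rw [if_neg (hle.trans_lt h).ne', decide_eq_false_iff_not]
      rintro ⟨⟨p, hp⟩, ⟨q, hq⟩, hpq, hpe, hqe⟩
      simp only [List.get_eq_getElem] at hpe hqe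
      have := (hnd.getElem_inj_iff).1 hqe
      subst this
      exact no_big_peak l hnd hpk hc p q j hpq hij hj (by rw [hpe, h2, ← heq, hk'])
        (by rw [hpe]; exact hle.trans_lt h) h

end Helpers

/-- For a non-empty `m`-colored poset `P` with `k` distinct colors, the number
of `m`-colored enriched `P`-partitions `f` with `|f i| = ω^{ε(i)}1` for every
`i ∈ P` equals `2^k` times the number of linear extensions `π ∈ L(P)` with
`Pe(π) = ∅` and weakly increasing colors.  (This computes the odd character
value `ν_P(P) = ζ_Q(Λ_m(P))`.) -/
theorem statement19 {m : ℕ} (P : ColoredPoset m) (hne : P.carrier.Nonempty) :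
    Nat.card {f : {x // x ∈ P.carrier} → Lex (Lex (ℕ+ × Fin m) × Bool) //
        IsColoredEnrichedPPartition P.lt f ∧
        ∀ i, (ofLex (f i)).1 = toLex ((1 : ℕ+), (ofLex i.1).2)} =
      2 ^ (P.carrier.image (fun z => (ofLex z).2)).card *
        Nat.card {π : List (Lex (ℕ+ × Fin m)) //
          IsLinearExtension (· ∈ P.carrier) P.lt π ∧
          (∀ t ∈ π.zip (π.tail.zip π.tail.tail),
            (ofLex t.1).2 = (ofLex t.2.1).2 → (ofLex t.2.1).2 = (ofLex t.2.2).2 →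
            ¬(t.1 < t.2.1 ∧ t.2.2 < t.2.1)) ∧
          π.Chain' (fun a b => (ofLex a).2 ≤ (ofLex b).2)} := by
  classical
  choose μ hμ using exists_mins P.carrier
  -- the sorted list
  choose srt hs1 hs2 hs3 using fun s => exists_sorted_s19 s P.carrier
  have trans_col : ∀ l : List (Lex (ℕ+ × Fin m)),
      l.Chain' (fun a b => (ofLex a).2 ≤ (ofLex b).2) ↔
        l.Pairwise (fun a b => colr a ≤ colr b) := by
    intro l
    haveI : IsTrans (Lex (ℕ+ × Fin m)) (fun a b => colr a ≤ colr b) :=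
      ⟨fun a b c h1 h2 => le_trans h1 h2⟩
    exact List.isChain_iff_pairwise (R := fun a b : Lex (ℕ+ × Fin m) => colr a ≤ colr b)
  have bef_col : ∀ s (a b : Lex (ℕ+ × Fin m)), bef s a b → colr a ≤ colr b := by
    rintro s a b (h | h)
    · exact h.le
    · exact h.1.le
  have hcard : 2 ^ (P.carrier.image (fun z => (ofLex z).2)).card =
      Nat.card ({k // k ∈ P.carrier.image (fun z => (ofLex z).2)} → Bool) := by
    rw [Nat.card_fun, Nat.card_eq_fintype_card, Nat.card_eq_fintype_card, Fintype.card_coe,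
      Fintype.card_bool]
  rw [hcard, ← Nat.card_prod]
  refine Nat.card_congr (Equiv.ofBijective (fun f => (fun k => sg f.1 (μ k),
    ⟨srt (sg f.1), ⟨hs1 _, hs2 _, fun a b hab => ?_⟩, noPeak_of_pairwise _ _ (hs3 _),
      (trans_col _).2 ((hs3 _).imp (fun h => bef_col _ _ _ h))⟩)) ⟨?_, ?_⟩)
  · have hm := P.mem_of_lt hab
    exact chainRel_of_pairwise _ _ (hs3 _) ((hs2 _ _).2 hm.1) ((hs2 _ _).2 hm.2)
      ((enriched_iff_s19 P f.1 f.2.2).1 f.2.1 a b hab)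
  · rintro ⟨f, hf, hf'⟩ ⟨f', hg, hg'⟩ heq
    simp only [Prod.mk.injEq, Subtype.mk.injEq] at heq
    obtain ⟨e1, e2⟩ := heq
    have hsg : ∀ x ∈ P.carrier, sg f x = sg f' x := by
      intro x hx
      obtain ⟨h1, h2, h3⟩ := hμ ⟨colr x, Finset.mem_image.2 ⟨x, hx, rfl⟩⟩
      have e1 := congrFun e1 ⟨colr x, Finset.mem_image.2 ⟨x, hx, rfl⟩⟩
      generalize μ ⟨colr x, Finset.mem_image.2 ⟨x, hx, rfl⟩⟩ = y at *
      rcases (h3 x hx rfl).eq_or_lt with rfl | hlt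
      · exact e1
      have key : ∀ s, sg f = s ∨ sg f' = s → (chainRel (srt s) y x ↔ s x = true) := by
        intro s _
        have : bef s y x ↔ s x = true := by
          unfold bef
          simp only at h2
          simp [h2, hlt, hlt.not_gt]
        rw [← this]
        exact ⟨fun h => bef_of_chainRel s _ (hs3 s) h,
          fun h => chainRel_of_pairwise s _ (hs3 s) ((hs2 _ _).2 h1) ((hs2 _ _).2 hx) h⟩
      rw [Bool.eq_iff_iff, ← key _ (Or.inl rfl), ← key _ (Or.inr rfl), e2]
    apply Subtype.ext
    funext i
    show f i = f' i
    have := hsg i.1 i.2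
    simp only [sg, i.2, dif_pos] at this
    rw [← ofLex_inj]
    exact Prod.ext ((hf' i).trans (hg' i).symm) this
  · rintro ⟨g, l, ⟨hnd, hm, hlin⟩, hpk, hcol⟩
    obtain ⟨s, hsg, hsp⟩ := exists_sign P.carrier μ hμ g l hnd hm hpk ((trans_col l).1 hcol)
    let f : {x // x ∈ P.carrier} → Lex (Lex (ℕ+ × Fin m) × Bool) :=
      fun i => toLex (toLex ((1 : ℕ+), (ofLex i.1).2), s i.1)
    have hfs : ∀ x ∈ P.carrier, sg f x = s x := by
      intro x hx
      simp [sg, f, hx]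
    have hbef : ∀ a ∈ P.carrier, ∀ b ∈ P.carrier, bef s a b → bef (sg f) a b := by
      intro a ha b hb h
      unfold bef at *
      rwa [hfs a ha, hfs b hb]
    have hlp : l.Pairwise (bef (sg f)) :=
      List.Pairwise.imp_of_mem (fun ha hb h => hbef _ ((hm _).1 ha) _ ((hm _).1 hb) h) hsp
    refine ⟨⟨f, (enriched_iff_s19 P f (fun i => rfl)).2 (fun a b hab =>
      bef_of_chainRel _ l hlp (hlin a b hab)), fun i => rfl⟩, ?_⟩
    refine Prod.ext ?_ (Subtype.ext ?_)
    · funext k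
      exact (hfs _ (hμ k).1).trans (hsg k)
    · exact sorted_unique _ _ _ (hs1 _) hnd (fun x => (hs2 _ x).trans (hm x).symm) (hs3 _) hlp
end
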